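/- arXiv:2006.15534 — 3 statements merged into one kernel-verified Lean document; each statement's English description precedes it below -/
import Mathlib

section
/- Let λ = (λ_1, λ_2, …, λ_r) be a partition. If z ∈ ℝ is a real root of the Wronskian Hermite polynomial He_λ(x), then |z| ≤ x_{λ_1+r−1}, where x_{λ_1+r−1} is the largest real root of the probabilist Hermite polynomial He_{λ_1+r−1}(x). -/
open Polynomial

/-- Probabilist Hermite polynomials. -/
noncomputable def He : ℕ → Polynomial ℝ
  | 0 => 1
  | 1 => X
  | (n + 2) => X * He (n + 1) - C ((n : ℝ) + 1) * He n

/-- Wronskian determinant of a family of polynomials. -/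
noncomputable def Wr {r : ℕ} (f : Fin r → Polynomial ℝ) : Polynomial ℝ :=
  (Matrix.of fun i j : Fin r => (derivative^[(i : ℕ)] (f j))).det

/-- Degree vector of a partition given by its (weakly decreasing) parts:
`n_λ = (λ_r, λ_{r-1}+1, …, λ_1+r-1)`. -/
def degVec {r : ℕ} (l : Fin r → ℕ) : Fin r → ℕ := fun i => l i.rev + (i : ℕ)

/-- Vandermonde determinant `Δ(v) = ∏_{i<j} (v_j - v_i)`. -/
noncomputable def vand {r : ℕ} (v : Fin r → ℕ) : ℝ :=
  ∏ j : Fin r, ∏ i : Fin r, if (i : ℕ) < (j : ℕ) then ((v j : ℝ) - (v i : ℝ)) else 1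

/-- Wronskian Hermite polynomial associated to a partition:
`He_λ = Wr[He_{n_1}, …, He_{n_r}] / Δ(n_λ)`. -/
noncomputable def HeW {r : ℕ} (l : Fin r → ℕ) : Polynomial ℝ :=
  C (vand (degVec l))⁻¹ * Wr (fun i => He (degVec l i))

/-- All minors of `v` formed by its first `r` coordinates and `r` increasing indices below `M`
are positive. -/
def PosMinors (r M : ℕ) (v : ℕ → ℕ → ℝ) : Prop :=
  ∀ k : Fin r → ℕ, StrictMono k → (∀ j, k j < M) →
    0 < (Matrix.of fun i j : Fin r => v (k j) i).det

namespace PosMinors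

variable {r M : ℕ} {v : ℕ → ℕ → ℝ}

theorem mono {M' : ℕ} (h : PosMinors r M v) (hM : M' ≤ M) : PosMinors r M' v :=
  fun k hk hkM => h k hk fun j => (hkM j).trans_le hM

theorem congr {v' : ℕ → ℕ → ℝ} (h : PosMinors r M v) (hv : ∀ n < M, v' n = v n) :
    PosMinors r M v' := by
  intro k hk hkM
  simpa only [hv _ (hkM _)] using h k hk hkM

theorem smul (h : PosMinors r M v) {c : ℕ → ℝ} (hc : ∀ n < M, 0 < c n) :
    PosMinors r M fun n i => c n * v n i := by
  intro k hk hkM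
  have := Matrix.det_mul_row (fun j => c (k j)) (Matrix.of fun i j : Fin r => v (k j) i)
  simp only [Matrix.of_apply] at this
  rw [this]
  exact mul_pos (Finset.prod_pos fun j _ => hc _ (hkM j)) (h k hk hkM)

theorem det_sum_pos (h : PosMinors r M v) (A : Fin r → Finset ℕ) (hA : ∀ j, (A j).Nonempty)
    (hAM : ∀ j, ∀ m ∈ A j, m < M) (hlt : ∀ i j, i < j → ∀ a ∈ A i, ∀ b ∈ A j, a < b) :
    0 < (Matrix.of fun i j : Fin r => ∑ m ∈ A j, v m i).det := by
  have key : (Matrix.of fun i j : Fin r => ∑ m ∈ A j, v m i).det =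
      ∑ k ∈ Fintype.piFinset A, (Matrix.of fun i j : Fin r => v (k j) i).det := by
    rw [← Matrix.det_transpose]
    have := (Matrix.detRowAlternating (R := ℝ) (n := Fin r)).toMultilinearMap.map_sum_finset
      (fun _ m => fun i : Fin r => v m i) A
    simp only [AlternatingMap.coe_multilinearMap] at this
    convert this using 1
    · change Matrix.detRowAlternating _ = _
      congr 1
      ext i j
      simp [Finset.sum_apply]
    · refine Finset.sum_congr rfl fun k _ => ?_
      rw [← Matrix.det_transpose]
      rfl
  rw [key]
  refine Finset.sum_pos (fun k hk => ?_) (Fintype.piFinset_nonempty.2 hA)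
  rw [Fintype.mem_piFinset] at hk
  exact h k (fun i j hij => hlt i j hij _ (hk i) _ (hk j)) fun j => hAM j _ (hk j)

theorem sum_range (h : PosMinors r M v) :
    PosMinors r M fun n i => ∑ m ∈ Finset.range (n + 1), v m i := by
  intro k hk hkM
  obtain _ | r := r
  · simp
  let lo : Fin (r + 1) → ℕ := Fin.cons 0 fun j => k j.castSucc + 1
  have hlo : ∀ j, lo j ≤ k j := by
    refine Fin.cases (by simp [lo]) fun j => ?_
    simpa [lo] using hk j.castSucc_lt_succ
  have hdet := Matrix.det_eq_of_forall_col_eq_smul_add_pred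
    (A := Matrix.of fun i j : Fin (r + 1) => ∑ m ∈ Finset.range (k j + 1), v m i)
    (B := Matrix.of fun i j : Fin (r + 1) => ∑ m ∈ Finset.Ico (lo j) (k j + 1), v m i)
    (fun _ => 1) (fun i => by simp [lo]) (fun i j => by
      have := Finset.sum_range_add_sum_Ico (fun m => v m i) (show lo j.succ ≤ k j.succ + 1 from
        (hlo _).trans (Nat.le_succ _))
      simp only [Matrix.of_apply, one_mul]
      rw [← this, add_comm]
      simp [lo])
  rw [hdet]
  refine h.det_sum_pos _ (fun j => ?_) (fun j m hm => ?_) fun i j hij a ha b hb => ?_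
  · simpa using hlo j
  · have := (Finset.mem_Ico.1 hm).2
    have := hkM j
    omega
  · have ha' := (Finset.mem_Ico.1 ha).2
    have hb' := (Finset.mem_Ico.1 hb).1
    obtain ⟨j, rfl⟩ := Fin.exists_succ_eq.2 (Fin.ne_zero_of_lt hij)
    have : k i ≤ k j.castSucc := hk.monotone (Fin.le_castSucc_iff.2 hij)
    simp [lo] at hb'
    omega

theorem succ_of_diff (h : PosMinors r M fun n i => v (n + 1) (i + 1) - v n (i + 1))
    (h1 : ∀ n ≤ M, v n 0 = 1) : PosMinors (r + 1) (M + 1) v := by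
  intro k hk hkM
  have hk1 (j) : v (k j) 0 = 1 := h1 _ (Nat.lt_succ_iff.1 (hkM j))
  have hdet := Matrix.det_eq_of_forall_col_eq_smul_add_pred
    (A := Matrix.of fun i j : Fin (r + 1) => v (k j) i)
    (B := Matrix.of fun i : Fin (r + 1) => Fin.cons (v (k 0) i)
      fun j : Fin r => v (k j.succ) i - v (k j.castSucc) i)
    (fun _ => 1) (fun i => by simp) (fun i j => by simp)
  rw [hdet, Matrix.det_succ_row_zero, Fin.sum_univ_succ]
  simp only [Matrix.of_apply, Fin.cons_zero, Fin.cons_succ, Fin.val_zero, hk1, sub_self]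
  simp only [pow_zero, mul_one, one_mul, mul_zero, zero_mul, Finset.sum_const_zero, add_zero]
  have := h.det_sum_pos (fun j => Finset.Ico (k j.castSucc) (k j.succ))
    (fun j => by simpa using hk j.castSucc_lt_succ)
    (fun j m hm => (Finset.mem_Ico.1 hm).2.trans_le (Nat.lt_succ_iff.1 (hkM _)))
    (fun i j hij a ha b hb => (Finset.mem_Ico.1 ha).2.trans_le
      ((hk.monotone (by simpa [Fin.le_def] using hij)).trans (Finset.mem_Ico.1 hb).1))
  convert this using 2
  ext i j
  simp only [Matrix.submatrix_apply, Matrix.of_apply, Fin.zero_succAbove, Fin.cons_succ,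
    Fin.val_succ]
  rw [Finset.sum_Ico_sub (fun n => v n (i + 1)) (hk.monotone j.castSucc_lt_succ.le)]

end PosMinors

/-- Taylor coefficients of the Hermite polynomials at `z`. -/
noncomputable def heCoeff (z : ℝ) (n i : ℕ) : ℝ := (taylor z (He n)).coeff i

theorem heCoeff_zero_right (z : ℝ) (n : ℕ) : heCoeff z n 0 = (He n).eval z := by
  simp [heCoeff, taylor_coeff_zero]

theorem heCoeff_add_two_succ (z : ℝ) (n i : ℕ) : heCoeff z (n + 2) (i + 1) =
    heCoeff z (n + 1) i + z * heCoeff z (n + 1) (i + 1) - (n + 1) * heCoeff z n (i + 1) := by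
  simp only [heCoeff, He, map_sub, taylor_mul, taylor_X, taylor_C, add_mul, coeff_sub, coeff_add,
    coeff_X_mul, coeff_C_mul]

/-- Christoffel–Darboux formula for the Hermite polynomials. -/
theorem heCoeff_christoffel_darboux (z : ℝ) (n i : ℕ) :
    heCoeff z n 0 * heCoeff z (n + 1) (i + 1) - heCoeff z (n + 1) 0 * heCoeff z n (i + 1) =
      n.factorial * ∑ j ∈ Finset.range (n + 1),
        heCoeff z j 0 / j.factorial * heCoeff z j i := by
  induction n with
  | zero =>
    simp [heCoeff, He, coeff_X, coeff_one, coeff_C]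
  | succ n ih =>
    rw [Finset.sum_range_succ, mul_add, Nat.factorial_succ, Nat.cast_mul, mul_assoc, ← ih,
      heCoeff_add_two_succ, heCoeff_zero_right z (n + 2)]
    have h : (He (n + 2)).eval z = z * heCoeff z (n + 1) 0 - (n + 1) * heCoeff z n 0 := by
      simp [He, heCoeff_zero_right]
    have : (n.factorial : ℝ) ≠ 0 := by positivity
    rw [h]
    push_cast
    field_simp
    ring

theorem posMinors_heCoeff {z : ℝ} {N : ℕ} (hpos : ∀ n ≤ N, 0 < (He n).eval z) (r : ℕ) :
    PosMinors r (N + 1) (heCoeff z) := by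
  have ha : ∀ n ≤ N, 0 < heCoeff z n 0 := fun n hn => by simpa [heCoeff_zero_right] using hpos n hn
  induction r with
  | zero => intro k _ _; simp
  | succ r ih =>
    have h1 := ((ih.mono N.le_succ).smul (c := fun n => heCoeff z n 0 / n.factorial)
      fun n hn => div_pos (ha n hn.le) (by positivity)).sum_range.smul
        (c := fun n => n.factorial / (heCoeff z n 0 * heCoeff z (n + 1) 0))
        fun n hn => div_pos (by positivity) (mul_pos (ha n hn.le) (ha _ hn))
    have h2 : PosMinors (r + 1) (N + 1) fun n i => heCoeff z n i / heCoeff z n 0 := by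
      refine PosMinors.succ_of_diff (h1.congr fun n hn => ?_) fun n hn => div_self (ha n hn).ne'
      funext i
      have := (ha n hn.le).ne'
      have := (ha _ hn).ne'
      rw [div_mul_eq_mul_div, ← heCoeff_christoffel_darboux]
      field_simp
    refine (h2.smul fun n hn => ha n (Nat.lt_succ_iff.1 hn)).congr fun n hn => ?_
    funext i
    have := (ha n (Nat.lt_succ_iff.1 hn)).ne'
    field_simp

theorem eval_iterate_derivative_eq (f : ℝ[X]) (z : ℝ) (i : ℕ) :
    (derivative^[i] f).eval z = i.factorial * (taylor z f).coeff i := by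
  rw [taylor_coeff, ← factorial_smul_hasseDeriv]
  simp

theorem eval_Wr {r : ℕ} (f : Fin r → ℝ[X]) (z : ℝ) : (Wr f).eval z =
    (Matrix.of fun i j : Fin r => (derivative^[(i : ℕ)] (f j)).eval z).det := by
  rw [Wr, ← coe_evalRingHom, RingHom.map_det]
  rfl

theorem eval_Wr_He_pos {z : ℝ} {N r : ℕ} (hpos : ∀ n ≤ N, 0 < (He n).eval z)
    {k : Fin r → ℕ} (hk : StrictMono k) (hkN : ∀ j, k j ≤ N) :
    0 < (Wr fun i => He (k i)).eval z := by
  rw [eval_Wr]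
  simp only [eval_iterate_derivative_eq]
  have := Matrix.det_mul_column (fun i : Fin r => ((i : ℕ).factorial : ℝ))
    (Matrix.of fun i j : Fin r => heCoeff z (k j) i)
  simp only [Matrix.of_apply, heCoeff] at this
  rw [this]
  exact mul_pos (Finset.prod_pos fun i _ => by positivity)
    (posMinors_heCoeff hpos r k hk fun j => Nat.lt_succ_iff.2 (hkN j))

theorem He_comp_neg (n : ℕ) : (He n).comp (-X) = C ((-1) ^ n) * He n := by
  induction n using Nat.twoStepInduction with
  | zero => simp [He]
  | one => simp [He]
  | more n h0 h1 =>
    simp only [He, sub_comp, mul_comp, X_comp, C_comp, h0, h1, pow_succ, C_mul, C_neg, C_1]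
    ring

theorem iterate_derivative_comp_neg_X (p : ℝ[X]) (i : ℕ) :
    derivative^[i] (p.comp (-X)) = (-1) ^ i * (derivative^[i] p).comp (-X) := by
  induction i generalizing p with
  | zero => simp
  | succ i ih =>
    simp only [Function.iterate_succ_apply, derivative_comp, derivative_neg, derivative_X,
      neg_one_mul, iterate_derivative_neg, ih, pow_succ]
    ring

theorem eval_neg_iterate_derivative_He (n i : ℕ) (z : ℝ) : (derivative^[i] (He n)).eval (-z) =
    (-1) ^ n * ((-1) ^ i * (derivative^[i] (He n)).eval z) := by
  have h : (derivative^[i] ((He n).comp (-X))).eval z =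
      (-1) ^ i * (derivative^[i] (He n)).eval (-z) := by
    rw [iterate_derivative_comp_neg_X]
    simp
  rw [He_comp_neg, iterate_derivative_C_mul, eval_C_mul] at h
  calc _ = (-1) ^ i * ((-1) ^ i * (derivative^[i] (He n)).eval (-z)) := by
        rw [← mul_assoc, ← mul_pow]; simp
    _ = _ := by rw [← h]; ring

theorem eval_neg_Wr_He_eq_zero {r : ℕ} {k : Fin r → ℕ} {z : ℝ}
    (h : (Wr fun i => He (k i)).eval z = 0) : (Wr fun i => He (k i)).eval (-z) = 0 := by
  rw [eval_Wr] at h ⊢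
  simp only [eval_neg_iterate_derivative_He]
  have h1 := Matrix.det_mul_row (fun j : Fin r => (-1 : ℝ) ^ k j) (Matrix.of fun i j : Fin r =>
    (-1) ^ (i : ℕ) * (derivative^[(i : ℕ)] (He (k j))).eval z)
  have h2 := Matrix.det_mul_column (fun i : Fin r => (-1 : ℝ) ^ (i : ℕ))
    (Matrix.of fun i j : Fin r => (derivative^[(i : ℕ)] (He (k j))).eval z)
  simp only [Matrix.of_apply] at h1 h2
  rw [h1, h2, h, mul_zero, mul_zero]

theorem He_monic_natDegree (n : ℕ) : (He n).Monic ∧ (He n).natDegree = n := by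
  induction n using Nat.twoStepInduction with
  | zero => simp [He]
  | one => simp [He]
  | more n h0 h1 =>
    have hd : (X * He (n + 1)).natDegree = n + 2 := by
      rw [natDegree_X_mul h1.1.ne_zero, h1.2]
    have hlt : (C ((n : ℝ) + 1) * He n).natDegree < (X * He (n + 1)).natDegree := by
      have := natDegree_C_mul_le ((n : ℝ) + 1) (He n)
      omega
    refine ⟨(monic_X.mul h1.1).sub_of_left (degree_lt_degree hlt), ?_⟩
    rw [He, natDegree_sub_eq_left_of_natDegree_lt hlt, hd]

theorem eventually_eval_He_pos (n : ℕ) : ∀ᶠ x in Filter.atTop, 0 < (He n).eval x := by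
  obtain ⟨hm, hd⟩ := He_monic_natDegree n
  obtain rfl | hn := n.eq_zero_or_pos
  · simp [He]
  · exact ((He n).tendsto_atTop_of_leadingCoeff_nonneg
      (natDegree_pos_iff_degree_pos.1 (hd.symm ▸ hn)) (by simp [hm.leadingCoeff])).eventually_gt_atTop 0

theorem eval_He_pos_of_ne_zero {n : ℕ} {a : ℝ} (h : ∀ x, a < x → (He n).eval x ≠ 0) :
    ∀ x, a < x → 0 < (He n).eval x := by
  intro x hx
  by_contra! hle
  obtain ⟨y, hy, hxy⟩ := ((eventually_eval_He_pos n).and (Filter.eventually_ge_atTop x)).exists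
  obtain ⟨c, hc, h0⟩ := intermediate_value_Icc hxy (He n).continuous.continuousOn ⟨hle, hy.le⟩
  exact h c (hx.trans_le hc.1) h0

theorem eval_He_pos_of_succ {n : ℕ} {a : ℝ} (h : ∀ x, a < x → 0 < (He (n + 1)).eval x) :
    ∀ x, a < x → 0 < (He n).eval x := by
  induction n generalizing a with
  | zero => simp [He]
  | succ n ih =>
    refine eval_He_pos_of_ne_zero fun x hx hx0 => ?_
    have hne : He (n + 1) ≠ 0 := (He_monic_natDegree _).1.ne_zero
    have hmem {t : ℝ} : t ∈ (He (n + 1)).roots.toFinset ↔ (He (n + 1)).eval t = 0 := by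
      simp [hne, IsRoot]
    obtain ⟨y, hy, hmax⟩ := (He (n + 1)).roots.toFinset.exists_max_image id ⟨x, hmem.2 hx0⟩
    have hay : a < y := hx.trans_le (hmax x (hmem.2 hx0))
    have hpos := ih (eval_He_pos_of_ne_zero (n := n + 1) (a := y)
      fun t ht h0 => ht.not_ge (hmax t (hmem.2 h0)))
    have hge : 0 ≤ (He n).eval y :=
      ge_of_tendsto ((He n).continuous.continuousWithinAt (s := Set.Ioi y) (x := y))
        (Filter.eventually_of_mem self_mem_nhdsWithin fun t ht => (hpos t ht).le)
    have := h y hay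
    rw [He] at this
    simp only [eval_sub, eval_mul, eval_X, eval_C, hmem.1 hy, mul_zero, zero_sub] at this
    nlinarith [mul_nonneg (show (0 : ℝ) ≤ n + 1 by positivity) hge]

theorem eval_He_pos_of_le {n N : ℕ} (hn : n ≤ N) {a : ℝ} (h : ∀ x, a < x → 0 < (He N).eval x) :
    ∀ x, a < x → 0 < (He n).eval x := by
  induction N, hn using Nat.le_induction with
  | base => exact h
  | succ N _ ih => exact ih (eval_He_pos_of_succ h)

theorem degVec_strictMono {r : ℕ} {l : Fin r → ℕ} (hl : Antitone l) : StrictMono (degVec l) :=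
  fun _ _ hij => add_lt_add_of_le_of_lt (hl (Fin.rev_le_rev.2 hij.le)) hij

theorem vand_ne_zero {r : ℕ} {v : Fin r → ℕ} (hv : Function.Injective v) : vand v ≠ 0 := by
  refine Finset.prod_ne_zero_iff.2 fun j _ => Finset.prod_ne_zero_iff.2 fun i _ => ?_
  split_ifs with h
  · rw [sub_ne_zero, Nat.cast_inj.ne]
    exact hv.ne (Fin.ne_of_gt h)
  · exact one_ne_zero

/-- **Proposition (real roots).** If λ = (λ₁, …, λ_r) is a partition and z is a
real root of He_λ, then |z| ≤ x_{λ₁+r−1}, the largest real root of He_{λ₁+r−1}. -/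
theorem real_root_bound {r : ℕ} (hr : 0 < r) (l : Fin r → ℕ) (hmono : Antitone l)
    (z : ℝ) (hz : (HeW l).eval z = 0)
    (xm : ℝ) (hxm : IsGreatest {x : ℝ | (He (l ⟨0, hr⟩ + r - 1)).eval x = 0} xm) :
    |z| ≤ xm := by
  by_contra! hlt
  have hpos := eval_He_pos_of_ne_zero fun x hx h0 => hx.not_ge (hxm.2 h0)
  have hW : (Wr fun i => He (degVec l i)).eval z = 0 := by
    simpa [HeW, vand_ne_zero (degVec_strictMono hmono).injective] using hz
  have hW' : (Wr fun i => He (degVec l i)).eval |z| = 0 := by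
    obtain h | h := abs_choice z <;> rw [h]
    exacts [hW, eval_neg_Wr_He_eq_zero hW]
  refine (eval_Wr_He_pos (fun n hn => eval_He_pos_of_le hn hpos _ hlt)
    (degVec_strictMono hmono) fun j => ?_).ne' hW'
  have : l j.rev ≤ l ⟨0, hr⟩ := hmono (Fin.mk_le_of_le_val (Nat.zero_le _))
  have := j.2
  simp only [degVec]
  omega
end

section
/- Let λ = (λ_1, λ_2) be a partition of n of length 2, so that its conjugate is λ' = (2^{λ_2} 1^{λ_1−λ_2}), and let μ^(k) := (2^k 1^{n−2k}) for 0 ≤ k ≤ ⌊n/2⌋. Then the Kostka number K_{λ'μ^(k)} equals 0 if k > λ_2, and equals (n−2k)!·(λ_1−λ_2+1) / ((λ_1−k+1)!·(λ_2−k)!) if k ≤ λ_2. -/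
/-- `T` is a semistandard Young tableau of shape `s` (row lengths), with positive
entries inside the diagram, `0` outside, rows weakly increasing and columns
strictly increasing. -/
def IsSSYT (s : ℕ → ℕ) (T : ℕ → ℕ → ℕ) : Prop :=
  (∀ i j, j < s i → 1 ≤ T i j) ∧
  (∀ i j, ¬ j < s i → T i j = 0) ∧
  (∀ i j, j + 1 < s i → T i j ≤ T i (j + 1)) ∧
  (∀ i j, j < s (i + 1) → T i j < T (i + 1) j)

/-- The Kostka number `K_{s m}`: the number of semistandard Young tableaux of
shape `s` (given by row lengths) and type `m` (where `m v` is the required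
number of occurrences of the entry `v`, for `v ≥ 1`). -/
noncomputable def kostka (s m : ℕ → ℕ) : ℕ :=
  Set.ncard {T : ℕ → ℕ → ℕ | IsSSYT s T ∧
    ∀ v, 1 ≤ v → {p : ℕ × ℕ | p.2 < s p.1 ∧ T p.1 p.2 = v}.ncard = m v}

/-- The conjugate partition of `l`, as a row-length function: the `j`-th row
(0-indexed) of the conjugate has length `#{i | l i > j}`. -/
def conjP {r : ℕ} (l : Fin r → ℕ) : ℕ → ℕ :=
  fun j => (Finset.univ.filter fun i : Fin r => j < l i).card

/-- The type `μ^(k) = (2^k 1^{n-2k})`: the value `v` occurs twice for `1 ≤ v ≤ k`,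
once for `k < v ≤ n - k`, and not at all otherwise. -/
def mu (k n : ℕ) : ℕ → ℕ :=
  fun v => if v = 0 then 0 else if v ≤ k then 2 else if v ≤ n - k then 1 else 0

/-- The semistandard tableaux of shape `s` and type `m`. -/
def tableaux (s m : ℕ → ℕ) : Set (ℕ → ℕ → ℕ) :=
  {T | IsSSYT s T ∧ ∀ v, 1 ≤ v → {p : ℕ × ℕ | p.2 < s p.1 ∧ T p.1 p.2 = v}.ncard = m v}

/-- The shape `s` with row `i` replaced by one of length `j + 1`. -/
def addCell (s : ℕ → ℕ) (i j : ℕ) : ℕ → ℕ := fun x => if x = i then j + 1 else s x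

/-- The filling `T` with the entry in cell `(i, j)` replaced by `N`. -/
def setEntry (N i j : ℕ) (T : ℕ → ℕ → ℕ) : ℕ → ℕ → ℕ :=
  fun x y => if x = i ∧ y = j then N else T x y

/-- The shape with columns of lengths `a` and `b`. -/
def twoCols (a b : ℕ) : ℕ → ℕ := fun i => (if i < a then 1 else 0) + (if i < b then 1 else 0)

theorem finite_cells_twoCols (a b : ℕ) : {p : ℕ × ℕ | p.2 < twoCols a b p.1}.Finite := by
  refine ((Set.finite_Iio (a + b)).prod (Set.finite_Iio 2)).subset ?_
  rintro ⟨x, y⟩ h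
  simp only [twoCols, Set.mem_ofPred_eq] at h
  simp only [Set.mem_prod, Set.mem_Iio]
  split_ifs at h <;> omega

theorem antitone_twoCols (a b : ℕ) : Antitone (twoCols a b) := by
  intro x y h
  simp only [twoCols]
  split_ifs <;> omega

theorem ncard_setEntry_eq {s : ℕ → ℕ} (hs : {p : ℕ × ℕ | p.2 < s p.1}.Finite) {i j : ℕ}
    (hij : s i = j) (N : ℕ) (T : ℕ → ℕ → ℕ) (v : ℕ) :
    {p : ℕ × ℕ | p.2 < addCell s i j p.1 ∧ setEntry N i j T p.1 p.2 = v}.ncard =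
      {p : ℕ × ℕ | p.2 < s p.1 ∧ T p.1 p.2 = v}.ncard + if v = N then 1 else 0 := by
  have hfin : {p : ℕ × ℕ | p.2 < s p.1 ∧ T p.1 p.2 = v}.Finite := hs.subset fun p hp => hp.1
  have hnot : (i, j) ∉ {p : ℕ × ℕ | p.2 < s p.1 ∧ T p.1 p.2 = v} := fun h => by
    have := h.1
    simp only at this
    omega
  split_ifs with hv
  · rw [← Set.ncard_insert_of_notMem hnot hfin]
    congr 1
    ext ⟨x, y⟩
    simp only [addCell, setEntry, Set.mem_ofPred_eq, Set.mem_insert_iff, Prod.mk.injEq]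
    grind
  · rw [add_zero]
    congr 1
    ext ⟨x, y⟩
    simp only [addCell, setEntry, Set.mem_ofPred_eq]
    grind

theorem apply_lt_of_mem_tableaux {s m : ℕ → ℕ} (hs : {p : ℕ × ℕ | p.2 < s p.1}.Finite) {N : ℕ}
    (hm : ∀ v, N ≤ v → m v = 0) {T : ℕ → ℕ → ℕ} (hT : T ∈ tableaux s m) {x y : ℕ}
    (h : y < s x) : T x y < N := by
  by_contra! hN
  have h0 := hT.2 (T x y) (hT.1.1 x y h)
  rw [hm _ hN, Set.ncard_eq_zero (hs.subset fun p hp => hp.1)] at h0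
  exact Set.notMem_empty (x, y) (h0 ▸ ⟨h, rfl⟩)

/-- Adding a corner cell with a new largest entry `N` gives a bijection onto the tableaux of the
larger shape having `N` in that cell. -/
theorem bijOn_setEntry {s m m' : ℕ → ℕ} (hs : {p : ℕ × ℕ | p.2 < s p.1}.Finite)
    (hanti : Antitone s) {i j N : ℕ} (hij : s i = j) (habove : ∀ x, x + 1 = i → j < s x)
    (hN : 1 ≤ N) (hm : ∀ v, N ≤ v → m v = 0)
    (hm' : ∀ v, 1 ≤ v → m' v = m v + if v = N then 1 else 0) :
    Set.BijOn (setEntry N i j) (tableaux s m) {T ∈ tableaux (addCell s i j) m' | T i j = N} := by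
  have hbelow : s (i + 1) ≤ j := hij ▸ hanti (Nat.le_succ i)
  refine ⟨fun T hT => ⟨⟨⟨?_, ?_, ?_, ?_⟩, ?_⟩, by simp [setEntry]⟩, ?_, ?_⟩
  · have := hT.1.1
    simp only [addCell, setEntry]
    grind
  · have := hT.1.2.1
    simp only [addCell, setEntry]
    grind
  · have h3 := hT.1.2.2.1
    have hlt : ∀ x y, y < s x → T x y < N := fun x y => apply_lt_of_mem_tableaux hs hm hT
    intro x y hxy
    have := h3 x y
    have := hlt x y
    simp only [addCell, setEntry] at *
    grind
  · have h4 := hT.1.2.2.2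
    have hlt : ∀ x y, y < s x → T x y < N := fun x y => apply_lt_of_mem_tableaux hs hm hT
    intro x y hxy
    have := h4 x y
    have := hlt x y
    have := habove x
    simp only [addCell, setEntry] at *
    grind
  · intro v hv
    rw [ncard_setEntry_eq hs hij, hT.2 v hv, hm' v hv]
  · intro T hT U hU h
    funext x y
    by_cases hxy : x = i ∧ y = j
    · have hcell : ¬ y < s x := by
        rw [hxy.1, hxy.2]
        omega
      rw [hT.1.2.1 x y hcell, hU.1.2.1 x y hcell]
    · simpa [setEntry, hxy] using congrFun₂ h x y
  · rintro T ⟨hT, hTN⟩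
    have hset : setEntry N i j (setEntry 0 i j T) = T := by
      funext x y
      simp only [setEntry]
      grind
    refine ⟨setEntry 0 i j T, ⟨⟨?_, ?_, ?_, ?_⟩, ?_⟩, hset⟩
    · intro x y hxy
      have := hT.1.1 x y
      simp only [addCell, setEntry] at *
      grind
    · intro x y hxy
      have := hT.1.2.1 x y
      simp only [addCell, setEntry] at *
      grind
    · intro x y hxy
      have := hT.1.2.2.1 x y
      simp only [addCell, setEntry] at *
      grind
    · intro x y hxy
      have := hT.1.2.2.2 x y
      simp only [addCell, setEntry] at *
      grind
    · intro v hv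
      have h := ncard_setEntry_eq hs hij N (setEntry 0 i j T) v
      rw [hset, hT.2 v hv, hm' v hv] at h
      omega

theorem mu_succ {k n : ℕ} (h : 2 * k ≤ n) (v : ℕ) :
    mu k (n + 1) v = mu k n v + if v = n + 1 - k then 1 else 0 := by
  simp only [mu]
  split_ifs <;> omega

theorem mu_eq_zero {k n v : ℕ} (h : 2 * k ≤ n) (hv : n + 1 - k ≤ v) : mu k n v = 0 := by
  simp only [mu]
  split_ifs <;> omega

theorem bijOn_setEntry_left {a b k : ℕ} (hab : b ≤ a) (hk : 2 * k ≤ a + b) :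
    Set.BijOn (setEntry (a + b + 1 - k) a 0) (tableaux (twoCols a b) (mu k (a + b)))
      {T ∈ tableaux (twoCols (a + 1) b) (mu k (a + b + 1)) | T a 0 = a + b + 1 - k} := by
  have hshape : twoCols (a + 1) b = addCell (twoCols a b) a 0 := by
    funext x
    simp only [twoCols, addCell]
    split_ifs <;> omega
  rw [hshape]
  refine bijOn_setEntry (finite_cells_twoCols a b) (antitone_twoCols a b) ?_ ?_ (by omega)
    (fun v => mu_eq_zero hk) (fun v _ => mu_succ hk v)
  · simp [twoCols, hab]
  · intro x hx
    simp only [twoCols]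
    split_ifs <;> omega

theorem bijOn_setEntry_right {a b k : ℕ} (hab : b < a) (hk : 2 * k ≤ a + b) :
    Set.BijOn (setEntry (a + b + 1 - k) b 1) (tableaux (twoCols a b) (mu k (a + b)))
      {T ∈ tableaux (twoCols a (b + 1)) (mu k (a + b + 1)) | T b 1 = a + b + 1 - k} := by
  have hshape : twoCols a (b + 1) = addCell (twoCols a b) b 1 := by
    funext x
    simp only [twoCols, addCell]
    split_ifs <;> omega
  rw [hshape]
  refine bijOn_setEntry (finite_cells_twoCols a b) (antitone_twoCols a b) ?_ ?_ (by omega)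
    (fun v => mu_eq_zero hk) (fun v _ => mu_succ hk v)
  · simp [twoCols, hab]
  · intro x hx
    simp only [twoCols]
    split_ifs <;> omega

/-- The largest entry of a tableau with two columns sits at a corner. -/
theorem exists_corner_eq {a b k : ℕ} (hab : b ≤ a) (hk : 2 * k < a + b) {T : ℕ → ℕ → ℕ}
    (hT : T ∈ tableaux (twoCols a b) (mu k (a + b))) :
    (b < a ∧ T (a - 1) 0 = a + b - k ∧ ∀ y, y < b → T y 1 ≠ a + b - k) ∨
      (0 < b ∧ T (b - 1) 1 = a + b - k ∧ ∀ x, x < a → T x 0 ≠ a + b - k) := by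
  set N := a + b - k with hN
  have hlt : ∀ x y, y < twoCols a b x → T x y < N + 1 := fun x y =>
    apply_lt_of_mem_tableaux (finite_cells_twoCols a b)
      (fun v hv => mu_eq_zero (by omega) (by omega)) hT
  have hcell0 : ∀ x, x < a → 0 < twoCols a b x := by
    intro x hx
    simp [twoCols, hx]
  have hcell1 : ∀ x, x < b → 1 < twoCols a b x := by
    intro x hx
    simp [twoCols, hx, hx.trans_le hab]
  have hone := hT.2 N (by omega)
  rw [show mu k (a + b) N = 1 by simp only [mu]; split_ifs <;> omega, Set.ncard_eq_one] at hone
  obtain ⟨⟨x, y⟩, hxy⟩ := hone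
  have huniq : ∀ u w, w < twoCols a b u → T u w = N → u = x ∧ w = y := fun u w h1 h2 => by
    have : (u, w) ∈ ({(x, y)} : Set (ℕ × ℕ)) := hxy ▸ ⟨h1, h2⟩
    simpa using this
  obtain ⟨hin, hval⟩ : y < twoCols a b x ∧ T x y = N := by
    have : (x, y) ∈ ({(x, y)} : Set (ℕ × ℕ)) := rfl
    rw [← hxy] at this
    exact this
  have hbottom : twoCols a b (x + 1) ≤ y := by
    by_contra! h
    have := hT.1.2.2.2 x y h
    have := hlt _ _ h
    omega
  have hright : twoCols a b x ≤ y + 1 := by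
    by_contra! h
    have := hT.1.2.2.1 x y h
    have := hlt _ _ h
    have := huniq x (y + 1) h (by omega)
    omega
  have hy : y = 0 ∨ y = 1 := by
    simp only [twoCols] at hin
    split_ifs at hin <;> omega
  rcases hy with rfl | rfl
  · left
    have hx : b < a ∧ x = a - 1 := by
      simp only [twoCols] at hin hbottom hright
      split_ifs at hin hbottom hright <;> omega
    refine ⟨hx.1, hx.2 ▸ hval, fun u hu h => ?_⟩
    have := huniq u 1 (hcell1 u hu) h
    omega
  · right
    have hx : 0 < b ∧ x = b - 1 := by
      simp only [twoCols] at hin hbottom hright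
      split_ifs at hin hbottom hright <;> omega
    refine ⟨hx.1, hx.2 ▸ hval, fun u hu h => ?_⟩
    have := huniq u 0 (hcell0 u hu) h
    omega

theorem strictMono_column {s : ℕ → ℕ} (hs : Antitone s) {T : ℕ → ℕ → ℕ} (hT : IsSSYT s T)
    {x y j : ℕ} (hxy : x < y) (hy : j < s y) : T x j < T y j := by
  induction y, hxy using Nat.le_induction with
  | base => exact hT.2.2.2 x j hy
  | succ y _ ih => exact (ih (hy.trans_le (hs (Nat.le_succ y)))).trans (hT.2.2.2 y j hy)

/-- There are no tableaux when more entries are repeated than the second column has cells. -/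
theorem tableaux_twoCols_eq_empty {a b k n : ℕ} (hbk : b < k) :
    tableaux (twoCols a b) (mu k n) = ∅ := by
  rw [Set.eq_empty_iff_forall_notMem]
  intro T hT
  have hsurj : Set.SurjOn (fun x => T x 1) (Finset.range b) (Finset.Icc 1 k) := by
    intro v hv
    rw [Finset.coe_Icc, Set.mem_Icc] at hv
    have h2 := hT.2 v hv.1
    rw [show mu k n v = 2 by simp only [mu]; split_ifs <;> omega, Set.ncard_eq_two] at h2
    obtain ⟨⟨x, i⟩, ⟨y, j⟩, hne, hset⟩ := h2
    have hx : i < twoCols a b x ∧ T x i = v := by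
      have : (x, i) ∈ ({(x, i), (y, j)} : Set (ℕ × ℕ)) := by simp
      rw [← hset] at this
      exact this
    have hy : j < twoCols a b y ∧ T y j = v := by
      have : (y, j) ∈ ({(x, i), (y, j)} : Set (ℕ × ℕ)) := by simp
      rw [← hset] at this
      exact this
    have hcol : ∀ u, 1 < twoCols a b u → T u 1 = v →
        v ∈ (fun x => T x 1) '' (Finset.range b : Set ℕ) := by
      intro u hu hv
      refine ⟨u, ?_, hv⟩
      simp only [twoCols] at hu
      simp only [Finset.coe_range, Set.mem_Iio]
      split_ifs at hu <;> omega
    have hlt2 : ∀ u, twoCols a b u ≤ 2 := by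
      intro u
      simp only [twoCols]
      split_ifs <;> omega
    have := hlt2 x
    have := hlt2 y
    obtain rfl | rfl : i = 0 ∨ i = 1 := by omega
    · obtain rfl | rfl : j = 0 ∨ j = 1 := by omega
      · rcases lt_trichotomy x y with h | h | h
        · have := strictMono_column (antitone_twoCols a b) hT.1 h hy.1
          omega
        · exact absurd (by rw [h]) hne
        · have := strictMono_column (antitone_twoCols a b) hT.1 h hx.1
          omega
      · exact hcol y hy.1 hy.2
    · exact hcol x hx.1 hx.2
  have := Finset.card_le_card_of_surjOn _ hsurj
  simp only [Nat.card_Icc, Finset.card_range] at this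
  omega

/-- The two-column rectangle with all entries repeated has a single tableau. -/
theorem tableaux_twoCols_self (k : ℕ) :
    tableaux (twoCols k k) (mu k (k + k)) =
      {fun i j => if j < twoCols k k i then i + 1 else 0} := by
  ext T
  rw [Set.mem_singleton_iff]
  constructor
  · intro hT
    have hlow : ∀ x j, j < twoCols k k x → x + 1 ≤ T x j := by
      intro x j
      induction x with
      | zero => exact hT.1.1 0 j
      | succ x ih =>
        intro h
        have := ih (h.trans_le (antitone_twoCols k k (Nat.le_succ x)))
        have := hT.1.2.2.2 x j h
        omega
    have hhigh : ∀ d x j, x + d + 1 = k → j < twoCols k k x → T x j ≤ x + 1 := by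
      intro d
      induction d with
      | zero =>
        intro x j hx h
        have := apply_lt_of_mem_tableaux (N := k + 1) (finite_cells_twoCols k k)
          (fun v hv => mu_eq_zero (by omega) (by omega)) hT h
        omega
      | succ d ih =>
        intro x j hx h
        have h' : j < twoCols k k (x + 1) := by
          simp only [twoCols] at h ⊢
          split_ifs at h ⊢ <;> omega
        have := ih (x + 1) j (by omega) h'
        have := hT.1.2.2.2 x j h'
        omega
    funext x j
    split_ifs with h
    · refine le_antisymm (hhigh (k - 1 - x) x j ?_ h) (hlow x j h)
      simp only [twoCols] at h
      split_ifs at h <;> omega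
    · exact hT.1.2.1 x j h
  · rintro rfl
    have hanti := antitone_twoCols k k
    refine ⟨⟨?_, ?_, ?_, ?_⟩, ?_⟩
    · intro i j h
      simp [h]
    · intro i j h
      simp [h]
    · intro i j h
      simp [h, (Nat.lt_succ_self j).trans h]
    · intro i j h
      simp [h, h.trans_le (hanti (Nat.le_succ i))]
    · intro v hv
      by_cases hvk : v ≤ k
      · have hset : {p : ℕ × ℕ | p.2 < twoCols k k p.1 ∧
            (if p.2 < twoCols k k p.1 then p.1 + 1 else 0) = v} = {(v - 1, 0), (v - 1, 1)} := by
          ext ⟨x, y⟩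
          simp only [twoCols, Set.mem_ofPred_eq, Set.mem_insert_iff, Set.mem_singleton_iff,
            Prod.mk.injEq]
          split_ifs <;> omega
        rw [hset, Set.ncard_pair (by simp)]
        simp only [mu]
        split_ifs <;> omega
      · have hset : {p : ℕ × ℕ | p.2 < twoCols k k p.1 ∧
            (if p.2 < twoCols k k p.1 then p.1 + 1 else 0) = v} = ∅ := by
          ext ⟨x, y⟩
          simp only [twoCols, Set.mem_ofPred_eq, Set.mem_empty_iff_false, iff_false]
          split_ifs <;> omega
        rw [hset, Set.ncard_empty, mu_eq_zero] <;> omega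

theorem tableaux_eq_image_left {a k : ℕ} (hk : k ≤ a) :
    tableaux (twoCols (a + 1) k) (mu k (a + 1 + k)) =
      setEntry (a + k + 1 - k) a 0 '' tableaux (twoCols a k) (mu k (a + k)) := by
  rw [(bijOn_setEntry_left hk (by omega)).image_eq, show a + 1 + k = a + k + 1 by omega]
  refine (Set.sep_eq_self_iff_mem_true.2 fun T hT => ?_).symm
  rw [show a + k + 1 = a + 1 + k by omega] at hT ⊢
  rcases exists_corner_eq (by omega) (by omega) hT with ⟨_, h, _⟩ | ⟨hpos, h, _⟩
  · exact h
  · obtain ⟨b, rfl⟩ := Nat.exists_eq_add_of_lt hpos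
    rw [zero_add] at *
    have hright := bijOn_setEntry_right (a := a + 1) (b := b) (k := b + 1) (by omega) (by omega)
    rw [tableaux_twoCols_eq_empty (Nat.lt_succ_self b)] at hright
    have hmem := hright.image_eq.symm.subset ⟨hT, h⟩
    simp at hmem

theorem tableaux_eq_image_right {b k : ℕ} (hk : k ≤ b) :
    tableaux (twoCols (b + 1) (b + 1)) (mu k (b + 1 + (b + 1))) =
      setEntry (b + 1 + b + 1 - k) b 1 '' tableaux (twoCols (b + 1) b) (mu k (b + 1 + b)) := by
  rw [(bijOn_setEntry_right (by omega) (by omega)).image_eq, ← add_assoc]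
  refine (Set.sep_eq_self_iff_mem_true.2 fun T hT => ?_).symm
  rcases exists_corner_eq le_rfl (by omega) hT with ⟨h, _⟩ | ⟨_, h, _⟩
  · omega
  · exact h

theorem tableaux_eq_union {a b k : ℕ} (hba : b < a) (hk : k ≤ b) :
    tableaux (twoCols (a + 1) (b + 1)) (mu k (a + 1 + (b + 1))) =
      setEntry (a + (b + 1) + 1 - k) a 0 '' tableaux (twoCols a (b + 1)) (mu k (a + (b + 1))) ∪
      setEntry (a + 1 + b + 1 - k) b 1 '' tableaux (twoCols (a + 1) b) (mu k (a + 1 + b)) := by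
  rw [(bijOn_setEntry_right (by omega) (by omega)).image_eq,
    (bijOn_setEntry_left (by omega) (by omega)).image_eq,
    show a + (b + 1) + 1 = a + 1 + (b + 1) by omega, show a + 1 + b + 1 = a + 1 + (b + 1) by omega,
    ← Set.sep_or]
  refine (Set.sep_eq_self_iff_mem_true.2 fun T hT => ?_).symm
  rcases exists_corner_eq (by omega) (by omega) hT with ⟨_, h, _⟩ | ⟨_, h, _⟩
  · exact Or.inl h
  · exact Or.inr h

theorem disjoint_images {a b k : ℕ} (hba : b < a) (hk : k ≤ b) :
    Disjoint
      (setEntry (a + (b + 1) + 1 - k) a 0 '' tableaux (twoCols a (b + 1)) (mu k (a + (b + 1))))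
      (setEntry (a + 1 + b + 1 - k) b 1 '' tableaux (twoCols (a + 1) b) (mu k (a + 1 + b))) := by
  rw [(bijOn_setEntry_right (by omega) (by omega)).image_eq,
    (bijOn_setEntry_left (by omega) (by omega)).image_eq,
    show a + (b + 1) + 1 = a + 1 + (b + 1) by omega, show a + 1 + b + 1 = a + 1 + (b + 1) by omega,
    Set.disjoint_left]
  rintro T ⟨hT, h0⟩ ⟨-, h1⟩
  rcases exists_corner_eq (by omega) (by omega) hT with ⟨_, _, h⟩ | ⟨_, _, h⟩
  · exact h b (by omega) h1
  · exact h a (by omega) h0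

theorem tableaux_twoCols_ncard (k : ℕ) : ∀ N p q, p + q = N → q ≤ p →
    (tableaux (twoCols (k + p) (k + q)) (mu k (k + p + (k + q)))).Finite ∧
    ((tableaux (twoCols (k + p) (k + q)) (mu k (k + p + (k + q)))).ncard : ℝ) *
      ((p + 1).factorial * q.factorial) = (p + q).factorial * (p - q + 1) := by
  intro N
  induction N with
  | zero =>
    intro p q h _
    obtain ⟨rfl, rfl⟩ : p = 0 ∧ q = 0 := by omega
    simp [tableaux_twoCols_self]
  | succ N ih =>
    intro p q h hqp
    rcases q with _ | q
    · obtain ⟨p, rfl⟩ : ∃ r, p = r + 1 := ⟨p - 1, by omega⟩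
      obtain ⟨hfin, hcard⟩ := ih p 0 (by omega) (by omega)
      simp only [add_zero, ← add_assoc] at *
      rw [tableaux_eq_image_left (by omega),
        (bijOn_setEntry_left (by omega) (by omega)).injOn.ncard_image]
      refine ⟨hfin.image _, ?_⟩
      rw [Nat.factorial_succ (p + 1)]
      rw [Nat.factorial_succ p] at hcard ⊢
      push_cast at hcard ⊢
      linear_combination ((p : ℝ) + 2) * hcard
    · obtain ⟨p, rfl⟩ : ∃ r, p = r + 1 := ⟨p - 1, by omega⟩
      obtain ⟨hfin, hcard⟩ := ih (p + 1) q (by omega) (by omega)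
      rw [show p + 1 + (q + 1) = p + q + 1 + 1 by omega, Nat.factorial_succ (p + q + 1),
        Nat.factorial_succ q]
      rw [show p + 1 + q = p + q + 1 by omega] at hcard
      rcases hqp.eq_or_lt with heq | hlt
      · obtain rfl : q = p := by omega
        simp only [← add_assoc k] at *
        rw [tableaux_eq_image_right (by omega),
          (bijOn_setEntry_right (by omega) (by omega)).injOn.ncard_image]
        refine ⟨hfin.image _, ?_⟩
        push_cast at hcard ⊢
        linear_combination ((q : ℝ) + 1) * hcard
      · obtain ⟨hfin', hcard'⟩ := ih p (q + 1) (by omega) (by omega)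
        rw [← add_assoc p, Nat.factorial_succ q] at hcard'
        simp only [← add_assoc k] at *
        rw [tableaux_eq_union (by omega) (by omega),
          Set.ncard_union_eq (disjoint_images (by omega) (by omega)) (hfin'.image _)
            (hfin.image _),
          (bijOn_setEntry_left (by omega) (by omega)).injOn.ncard_image,
          (bijOn_setEntry_right (by omega) (by omega)).injOn.ncard_image]
        refine ⟨(hfin'.image _).union (hfin.image _), ?_⟩
        rw [Nat.factorial_succ (p + 1)] at hcard ⊢
        push_cast at hcard hcard' ⊢
        linear_combination ((q : ℝ) + 1) * hcard + ((p : ℝ) + 2) * hcard'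

theorem conjP_two (l : Fin 2 → ℕ) : conjP l = twoCols (l 0) (l 1) := by
  funext j
  rw [conjP, Finset.card_filter, Fin.sum_univ_two, twoCols]

/-- **Kostka numbers for length-2 partitions.** Let λ = (λ₁, λ₂) ⊢ n with
conjugate λ' = (2^{λ₂} 1^{λ₁−λ₂}) and μ^(k) = (2^k 1^{n−2k}).  Then
`K_{λ'μ^(k)} = 0` for `k > λ₂`, and
`K_{λ'μ^(k)} = (n−2k)!·(λ₁−λ₂+1)/((λ₁−k+1)!·(λ₂−k)!)` for `k ≤ λ₂`. -/
theorem kostka_two_parts {n : ℕ} (l : Fin 2 → ℕ) (hmono : Antitone l)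
    (hlen : 0 < l 1) (hsum : l 0 + l 1 = n) (k : ℕ) (hk : k ≤ n / 2) :
    (l 1 < k → kostka (conjP l) (mu k n) = 0) ∧
    (k ≤ l 1 → (kostka (conjP l) (mu k n) : ℝ) =
      (((n - 2 * k).factorial : ℝ) * ((l 0 - l 1 + 1 : ℕ) : ℝ)) /
        (((l 0 + 1 - k).factorial : ℝ) * ((l 1 - k).factorial : ℝ))) := by
  have hkostka : kostka (conjP l) (mu k n) =
      (tableaux (twoCols (l 0) (l 1)) (mu k (l 0 + l 1))).ncard := by
    rw [← conjP_two, hsum]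
    rfl
  have hl : l 1 ≤ l 0 := hmono (Fin.zero_le 1)
  rw [hkostka]
  refine ⟨fun h => by rw [tableaux_twoCols_eq_empty h, Set.ncard_empty], fun h => ?_⟩
  obtain ⟨q, hq⟩ := Nat.exists_eq_add_of_le h
  obtain ⟨p, hp⟩ := Nat.exists_eq_add_of_le (h.trans hl)
  have hcard := (tableaux_twoCols_ncard k _ p q rfl (by omega)).2
  rw [hp, hq, show n - 2 * k = p + q by omega, show k + p + 1 - k = p + 1 by omega,
    show k + q - k = q by omega, show k + p - (k + q) + 1 = p - q + 1 by omega, eq_div_iff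
      (by positivity), hcard]
  push_cast [show q ≤ p by omega]
  ring
end

section
/- Let R ≥ 0 and set I_R := (−∞, −R) ∪ (R, +∞). Suppose ψ_1, ψ_2 : ℝ → ℝ are twice differentiable on I_R and satisfy the Schrödinger equations −ψ_i''(x) + V(x)·ψ_i(x) = E_i·ψ_i(x) on I_R for i = 1, 2, for some function V : I_R → ℝ and real constants E_1 ≠ E_2, and suppose ψ_1 and ψ_2 do not vanish anywhere in I_R. If the Wronskian w(x) := ψ_1(x)·ψ_2'(x) − ψ_1'(x)·ψ_2(x) satisfies lim_{x→+∞} w(x) = 0 and lim_{x→−∞} w(x) = 0, then w(x) ≠ 0 for all x ∈ I_R. -/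
theorem StrictMonoOn.lt_of_tendsto_atTop {f : ℝ → ℝ} {a l : ℝ}
    (hf : StrictMonoOn f (Set.Ioi a)) (hlim : Filter.Tendsto f Filter.atTop (nhds l))
    {x : ℝ} (hx : a < x) : f x < l := by
  have hx' : a < x + 1 := by linarith
  refine (hf hx hx' (lt_add_one x)).trans_le (ge_of_tendsto hlim ?_)
  filter_upwards [Filter.eventually_ge_atTop (x + 1)] with y hy
  exact hf.monotoneOn hx' (hx'.trans_le hy) hy

theorem ne_of_tendsto_atTop_of_hasDerivAt_ne_zero {f f' : ℝ → ℝ} {a l : ℝ}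
    (hf : ∀ x, a < x → HasDerivAt f (f' x) x) (hf' : ∀ x, a < x → f' x ≠ 0)
    (hlim : Filter.Tendsto f Filter.atTop (nhds l)) {x : ℝ} (hx : a < x) : f x ≠ l := by
  have hcont : ContinuousOn f (Set.Ioi a) := fun y hy =>
    (hf y hy).continuousAt.continuousWithinAt
  rcases hasDerivWithinAt_forall_lt_or_forall_gt_of_forall_ne (convex_Ioi a)
    (fun y hy => (hf y hy).hasDerivWithinAt) (m := 0) hf' with h | h
  · have hanti : StrictAntiOn f (Set.Ioi a) := by
      refine strictAntiOn_of_deriv_neg (convex_Ioi a) hcont fun y hy => ?_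
      rw [interior_Ioi] at hy
      exact (hf y hy).deriv ▸ h y hy
    exact (neg_lt_neg_iff.mp (hanti.neg.lt_of_tendsto_atTop hlim.neg hx)).ne'
  · have hmono : StrictMonoOn f (Set.Ioi a) := by
      refine strictMonoOn_of_deriv_pos (convex_Ioi a) hcont fun y hy => ?_
      rw [interior_Ioi] at hy
      exact (hf y hy).deriv ▸ h y hy
    exact (hmono.lt_of_tendsto_atTop hlim hx).ne

theorem ne_of_tendsto_atBot_of_hasDerivAt_ne_zero {f f' : ℝ → ℝ} {a l : ℝ}
    (hf : ∀ x, x < a → HasDerivAt f (f' x) x) (hf' : ∀ x, x < a → f' x ≠ 0)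
    (hlim : Filter.Tendsto f Filter.atBot (nhds l)) {x : ℝ} (hx : x < a) : f x ≠ l := by
  have h := ne_of_tendsto_atTop_of_hasDerivAt_ne_zero (f := fun y => f (-y))
    (f' := fun y => -f' (-y)) (a := -a)
    (fun y hy => by
      simpa [Function.comp_def] using (hf (-y) (by linarith)).comp y (hasDerivAt_neg y))
    (fun y hy => neg_ne_zero.mpr (hf' (-y) (by linarith)))
    (hlim.comp Filter.tendsto_neg_atTop_atBot) (neg_lt_neg hx)
  simpa using h

theorem hasDerivAt_wronskian {ψ₁ ψ₂ : ℝ → ℝ} {v E₁ E₂ x : ℝ}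
    (h₁ : DifferentiableAt ℝ ψ₁ x) (h₁' : DifferentiableAt ℝ (deriv ψ₁) x)
    (h₂ : DifferentiableAt ℝ ψ₂ x) (h₂' : DifferentiableAt ℝ (deriv ψ₂) x)
    (hschr₁ : -deriv (deriv ψ₁) x + v * ψ₁ x = E₁ * ψ₁ x)
    (hschr₂ : -deriv (deriv ψ₂) x + v * ψ₂ x = E₂ * ψ₂ x) :
    HasDerivAt (fun y => ψ₁ y * deriv ψ₂ y - deriv ψ₁ y * ψ₂ y)
      ((E₁ - E₂) * (ψ₁ x * ψ₂ x)) x := by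
  refine ((h₁.hasDerivAt.mul h₂'.hasDerivAt).sub
    (h₁'.hasDerivAt.mul h₂.hasDerivAt)).congr_deriv ?_
  linear_combination ψ₂ x * hschr₁ - ψ₁ x * hschr₂

/-- **Observation (Wronskian of two Schrödinger solutions).** Let `R ≥ 0` and
`I_R = (−∞, −R) ∪ (R, +∞)`.  If `ψ₁, ψ₂` are twice differentiable on `I_R`,
satisfy `−ψᵢ'' + V·ψᵢ = Eᵢ·ψᵢ` on `I_R` with `E₁ ≠ E₂`, do not vanish on `I_R`,
and their Wronskian `w = ψ₁ψ₂' − ψ₁'ψ₂` tends to `0` at `±∞`, then `w` has no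
zeros in `I_R`. -/
theorem wronskian_no_zeros (R : ℝ) (hR : 0 ≤ R)
    (V ψ₁ ψ₂ : ℝ → ℝ) (E₁ E₂ : ℝ) (hE : E₁ ≠ E₂)
    (hdiff₁ : ∀ x ∈ Set.Iio (-R) ∪ Set.Ioi R,
      DifferentiableAt ℝ ψ₁ x ∧ DifferentiableAt ℝ (deriv ψ₁) x)
    (hdiff₂ : ∀ x ∈ Set.Iio (-R) ∪ Set.Ioi R,
      DifferentiableAt ℝ ψ₂ x ∧ DifferentiableAt ℝ (deriv ψ₂) x)
    (hschr₁ : ∀ x ∈ Set.Iio (-R) ∪ Set.Ioi R,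
      -deriv (deriv ψ₁) x + V x * ψ₁ x = E₁ * ψ₁ x)
    (hschr₂ : ∀ x ∈ Set.Iio (-R) ∪ Set.Ioi R,
      -deriv (deriv ψ₂) x + V x * ψ₂ x = E₂ * ψ₂ x)
    (hne₁ : ∀ x ∈ Set.Iio (-R) ∪ Set.Ioi R, ψ₁ x ≠ 0)
    (hne₂ : ∀ x ∈ Set.Iio (-R) ∪ Set.Ioi R, ψ₂ x ≠ 0)
    (htop : Filter.Tendsto (fun x => ψ₁ x * deriv ψ₂ x - deriv ψ₁ x * ψ₂ x)
      Filter.atTop (nhds 0))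
    (hbot : Filter.Tendsto (fun x => ψ₁ x * deriv ψ₂ x - deriv ψ₁ x * ψ₂ x)
      Filter.atBot (nhds 0)) :
    ∀ x ∈ Set.Iio (-R) ∪ Set.Ioi R,
      ψ₁ x * deriv ψ₂ x - deriv ψ₁ x * ψ₂ x ≠ 0 := by
  have hderiv : ∀ x ∈ Set.Iio (-R) ∪ Set.Ioi R,
      HasDerivAt (fun y => ψ₁ y * deriv ψ₂ y - deriv ψ₁ y * ψ₂ y)
        ((E₁ - E₂) * (ψ₁ x * ψ₂ x)) x := fun x hx =>
    hasDerivAt_wronskian (hdiff₁ x hx).1 (hdiff₁ x hx).2 (hdiff₂ x hx).1 (hdiff₂ x hx).2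
      (hschr₁ x hx) (hschr₂ x hx)
  have hne : ∀ x ∈ Set.Iio (-R) ∪ Set.Ioi R, (E₁ - E₂) * (ψ₁ x * ψ₂ x) ≠ 0 := fun x hx =>
    mul_ne_zero (sub_ne_zero.mpr hE) (mul_ne_zero (hne₁ x hx) (hne₂ x hx))
  rintro x (hx | hx)
  · exact ne_of_tendsto_atBot_of_hasDerivAt_ne_zero (fun y hy => hderiv y (Or.inl hy))
      (fun y hy => hne y (Or.inl hy)) hbot hx
  · exact ne_of_tendsto_atTop_of_hasDerivAt_ne_zero (fun y hy => hderiv y (Or.inr hy))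
      (fun y hy => hne y (Or.inr hy)) htop hx
end
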